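/- Fix y = (y₁,y₂,y₃) ∈ ℝ³ with y₃ > 0 and vectors g, ν ∈ ℝ³. Let vᵢ(x) = Σⱼ Σₖ Tˢᵢⱼₖ(x,y) νₖ gⱼ − Σⱼ Σₖ Tˢᵢⱼₖ(x,yᴵ) νᴵₖ gᴵⱼ. Then for every x = (x₁,x₂,0) with x ≠ yᴵ, the tangential components vanish, v₁(x) = v₂(x) = 0, and the normal component is v₃(x) = −2 y₃ G^Q[νᴵ, gᴵ](x,yᴵ). -/

import Mathlib

open Real Finset

noncomputable section

/-- Points in three-dimensional Euclidean space. -/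
abbrev E3 := EuclideanSpace ℝ (Fin 3)

/-- Partial derivative `∂f/∂xᵢ` of a scalar field on `ℝ³`. -/
def pd (i : Fin 3) (f : E3 → ℝ) (x : E3) : ℝ :=
  fderiv ℝ f x (EuclideanSpace.single i 1)

/-- Kronecker delta. -/
def kron (i j : Fin 3) : ℝ := if i = j then 1 else 0

/-- Reflected image point `yᴵ = (y₁, y₂, -y₃)`. -/
def reflPt (y : E3) : E3 := (EuclideanSpace.equiv (Fin 3) ℝ).symm ![y 0, y 1, -y 2]

/-- Reflected vector `fᴵ = (f₁, f₂, -f₃)`. -/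
def reflVec (f : Fin 3 → ℝ) : Fin 3 → ℝ := ![f 0, f 1, -f 2]

/-- Harmonic potential of a unit charge, `Gˢ(x,y) = 1/(4π|x-y|)`. -/
def GS (x y : E3) : ℝ := 1 / (4 * π * ‖x - y‖)

/-- Harmonic potential of a unit dipole with orientation `ν`:
`Gᴰ[ν](x,y) = Σᵢ νᵢ ∂/∂yᵢ Gˢ(x,y)`. -/
def GD (ν : Fin 3 → ℝ) (x y : E3) : ℝ := ∑ i, ν i * pd i (fun z => GS x z) y

/-- Harmonic potential of a unit quadrupole with orientations `ν, κ`: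
`G^Q[ν,κ](x,y) = Σᵢ Σⱼ νᵢ κⱼ ∂²/∂yᵢ∂yⱼ Gˢ(x,y)`. -/
def GQ (ν κ : Fin 3 → ℝ) (x y : E3) : ℝ :=
  ∑ i, ∑ j, ν i * κ j * pd i (fun z => pd j (fun w => GS x w) z) y

/-- The symmetric part of the Stokes doublet
`Tˢᵢⱼₖ(x,y) = (1/4π)[-(xᵢ-yᵢ)δⱼₖ/|x-y|³ + 3(xᵢ-yᵢ)(xⱼ-yⱼ)(xₖ-yₖ)/|x-y|⁵]`. -/
def TS (x y : E3) (i j k : Fin 3) : ℝ :=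
  (1 / (4 * π)) * (-(x i - y i) * kron j k / ‖x - y‖ ^ 3
    + 3 * (x i - y i) * (x j - y j) * (x k - y k) / ‖x - y‖ ^ 5)

/-- The symmetric-Stokes-doublet-minus-image velocity. -/
def vTS (y : E3) (g ν : Fin 3 → ℝ) (i : Fin 3) (x : E3) : ℝ :=
  (∑ j, ∑ k, TS x y i j k * ν k * g j)
    - ∑ j, ∑ k, TS x (reflPt y) i j k * reflVec ν k * reflVec g j

/-- The distance to `x` is differentiable away from `x`. -/
lemma hasFDerivAt_norm_const_sub {x y : E3} (h : x ≠ y) :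
    HasFDerivAt (fun z : E3 => ‖x - z‖) (-(‖x - y‖⁻¹ • innerSL ℝ (x - y))) y := by
  have hn : ‖x - y‖ ≠ 0 := norm_ne_zero_iff.mpr (sub_ne_zero.mpr h)
  have h1 : HasFDerivAt (fun z : E3 => x - z) (-ContinuousLinearMap.id ℝ E3) y :=
    (hasFDerivAt_id y).const_sub x
  have h2 := h1.norm_sq.sqrt (pow_ne_zero 2 hn)
  simp only [Real.sqrt_sq (norm_nonneg _)] at h2
  refine h2.congr_fderiv ?_
  ext v
  simp
  field_simp
  ring

lemma pd_GS {x y : E3} (h : x ≠ y) (j : Fin 3) :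
    pd j (fun w => GS x w) y = (4 * π)⁻¹ * ((x j - y j) * (‖x - y‖ ^ 3)⁻¹) := by
  have hn : ‖x - y‖ ≠ 0 := norm_ne_zero_iff.mpr (sub_ne_zero.mpr h)
  have h1 := ((hasDerivAt_inv hn).comp_hasFDerivAt y
    (hasFDerivAt_norm_const_sub h)).const_mul (4 * π)⁻¹
  have h2 : (fun w => GS x w) = fun w => (4 * π)⁻¹ * (Inv.inv ∘ fun z : E3 => ‖x - z‖) w := by
    funext w
    simp only [GS, one_div, mul_inv, Function.comp]
  rw [pd, h2, h1.fderiv]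
  simp [EuclideanSpace.inner_single_right]
  field_simp

lemma pd_pd_GS {x y : E3} (h : x ≠ y) (i j : Fin 3) :
    pd i (fun z => pd j (fun w => GS x w) z) y =
      (4 * π)⁻¹ * (3 * (x i - y i) * (x j - y j) / ‖x - y‖ ^ 5 - kron i j / ‖x - y‖ ^ 3) := by
  have hn : ‖x - y‖ ≠ 0 := norm_ne_zero_iff.mpr (sub_ne_zero.mpr h)
  have hev : (fun z => pd j (fun w => GS x w) z) =ᶠ[nhds y]
      fun z => (4 * π)⁻¹ * ((x j - z j) * (‖x - z‖ ^ 3)⁻¹) := by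
    filter_upwards [isOpen_ne.mem_nhds h.symm] with z hz using pd_GS (Ne.symm hz) j
  have h1 : HasFDerivAt (fun z : E3 => x j - z j) (-(EuclideanSpace.proj j : E3 →L[ℝ] ℝ)) y :=
    (EuclideanSpace.proj j : E3 →L[ℝ] ℝ).hasFDerivAt.const_sub (x j)
  have h2 := ((hasDerivAt_pow 3 ‖x - y‖).fun_inv (pow_ne_zero 3 hn)).comp_hasFDerivAt y
    (hasFDerivAt_norm_const_sub h)
  have h3 := (h1.mul h2).const_mul (4 * π)⁻¹
  rw [pd, hev.fderiv_eq]
  refine (congrArg (fun L : E3 →L[ℝ] ℝ => L (EuclideanSpace.single i 1)) h3.fderiv).trans ?_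
  have hk : (EuclideanSpace.single i (1 : ℝ) : E3) j = kron i j := by
    simp [kron, eq_comm]
  simp [EuclideanSpace.inner_single_right, -PiLp.single_apply, hk]
  field_simp
  ring

lemma norm_sub_reflPt {x : E3} (hx : x 2 = 0) (y : E3) : ‖x - reflPt y‖ = ‖x - y‖ := by
  simp [EuclideanSpace.norm_eq, Fin.sum_univ_three, reflPt, hx]

/-- on the plane `x₃ = 0` the tangential components of the
symmetric-Stokes-doublet-minus-image velocity vanish and the normal component is
`-2 y₃ G^Q[νᴵ, gᴵ](x, yᴵ)`. -/
theorem symmetric_doublet_image_boundary (y : E3) (hy : 0 < y 2) (g ν : Fin 3 → ℝ) :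
    ∀ x : E3, x 2 = 0 → x ≠ reflPt y →
      vTS y g ν 0 x = 0 ∧ vTS y g ν 1 x = 0 ∧
      vTS y g ν 2 x = -2 * y 2 * GQ (reflVec ν) (reflVec g) x (reflPt y) := by
  intro x hx hne
  have hn := norm_sub_reflPt hx y
  have h0 : reflPt y 0 = y 0 := rfl
  have h1 : reflPt y 1 = y 1 := rfl
  have h2 : reflPt y 2 = -y 2 := rfl
  refine ⟨?_, ?_, ?_⟩
  · simp [vTS, TS, Fin.sum_univ_three, hn, h0, h1, h2, hx, reflVec, kron]
    ring
  · simp [vTS, TS, Fin.sum_univ_three, hn, h0, h1, h2, hx, reflVec, kron]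
    ring
  · simp only [GQ, pd_pd_GS hne]
    simp [vTS, TS, Fin.sum_univ_three, hn, h0, h1, h2, hx, reflVec, kron]
    ring
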